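/- Let p be a prime, m, d ≥ 1, 0 ≤ a < d, 0 ≤ r < m, and h ≥ 2. Then #{n < x : n ≡ a (mod d), v_p(n^h !) ≡ r (mod m)} ≫ x^{4/(3h+1)} as x → ∞, where the implied constant depends only on p, h, d, m. -/

import Mathlib

open Polynomial in
/-- The cubic `m₃X³ + m₂X² - m₁X + m₀`. -/
noncomputable def signedCubic (m₀ m₁ m₂ m₃ : ℤ) : ℤ[X] :=
  C m₃ * X ^ 3 + C m₂ * X ^ 2 - C m₁ * X + C m₀

namespace signedCubic

open Polynomial

variable {m₀ m₁ m₂ m₃ : ℤ}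

lemma mul_eq (P : ℤ[X]) : signedCubic m₀ m₁ m₂ m₃ * P =
    C m₀ * P - C m₁ * (X * P) + C m₂ * (X * (X * P)) + C m₃ * (X * (X * (X * P))) := by
  unfold signedCubic; ring

lemma coeff_mul_zero (P : ℤ[X]) :
    (signedCubic m₀ m₁ m₂ m₃ * P).coeff 0 = m₀ * P.coeff 0 := by
  simp [mul_eq]

lemma coeff_mul_one (P : ℤ[X]) :
    (signedCubic m₀ m₁ m₂ m₃ * P).coeff 1 = m₀ * P.coeff 1 - m₁ * P.coeff 0 := by
  have hX1 (Q : ℤ[X]) : (X * Q).coeff 1 = Q.coeff 0 := coeff_X_mul Q 0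
  simp [mul_eq, hX1]

lemma coeff_mul_two (P : ℤ[X]) :
    (signedCubic m₀ m₁ m₂ m₃ * P).coeff 2 =
      m₀ * P.coeff 2 - m₁ * P.coeff 1 + m₂ * P.coeff 0 := by
  have hX1 (Q : ℤ[X]) : (X * Q).coeff 1 = Q.coeff 0 := coeff_X_mul Q 0
  have hX2 (Q : ℤ[X]) : (X * Q).coeff 2 = Q.coeff 1 := coeff_X_mul Q 1
  simp [mul_eq, hX1, hX2]

lemma coeff_mul_add_three (P : ℤ[X]) (i : ℕ) :
    (signedCubic m₀ m₁ m₂ m₃ * P).coeff (i + 3) =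
      m₀ * P.coeff (i + 3) - m₁ * P.coeff (i + 2) + m₂ * P.coeff (i + 1) + m₃ * P.coeff i := by
  simp [mul_eq, coeff_X_mul]

lemma natDegree_pow_le (h : ℕ) : ((signedCubic m₀ m₁ m₂ m₃) ^ h).natDegree ≤ 3 * h := by
  have : (signedCubic m₀ m₁ m₂ m₃).natDegree ≤ 3 := by
    unfold signedCubic; compute_degree
  calc _ ≤ h * (signedCubic m₀ m₁ m₂ m₃).natDegree := Polynomial.natDegree_pow_le
    _ ≤ _ := by nlinarith

lemma abs_coeff_mul_le {U B : ℤ} (h₀ : |m₀| ≤ U) (h₁ : |m₁| ≤ U) (h₂ : |m₂| ≤ U) (h₃ : |m₃| ≤ U)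
    {P : ℤ[X]} (hP : ∀ i, |P.coeff i| ≤ B) (i : ℕ) :
    |(signedCubic m₀ m₁ m₂ m₃ * P).coeff i| ≤ 4 * U * B := by
  have hU : 0 ≤ U := (abs_nonneg _).trans h₀
  have hB : 0 ≤ B := (abs_nonneg _).trans (hP 0)
  have key : ∀ {c : ℤ} (_ : |c| ≤ U) (j : ℕ), |c * P.coeff j| ≤ U * B := fun hc j => by
    rw [abs_mul]; exact mul_le_mul hc (hP j) (abs_nonneg _) hU
  have hUB : 0 ≤ U * B := mul_nonneg hU hB
  match i with
  | 0 =>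
    rw [coeff_mul_zero]
    linarith [key h₀ 0]
  | 1 =>
    rw [coeff_mul_one]
    have := abs_le.mp (key h₀ 1); have := abs_le.mp (key h₁ 0)
    rw [abs_le]; constructor <;> linarith
  | 2 =>
    rw [coeff_mul_two]
    have := abs_le.mp (key h₀ 2); have := abs_le.mp (key h₁ 1); have := abs_le.mp (key h₂ 0)
    rw [abs_le]; constructor <;> linarith
  | i + 3 =>
    rw [coeff_mul_add_three]
    have := abs_le.mp (key h₀ (i + 3)); have := abs_le.mp (key h₁ (i + 2))
    have := abs_le.mp (key h₂ (i + 1)); have := abs_le.mp (key h₃ i)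
    rw [abs_le]; constructor <;> linarith

lemma abs_coeff_pow_le {U : ℤ} (h₀ : |m₀| ≤ U) (h₁ : |m₁| ≤ U) (h₂ : |m₂| ≤ U) (h₃ : |m₃| ≤ U)
    (h i : ℕ) : |((signedCubic m₀ m₁ m₂ m₃) ^ h).coeff i| ≤ (4 * U) ^ h := by
  induction h generalizing i with
  | zero => simp only [pow_zero, coeff_one]; split_ifs <;> simp
  | succ h ih =>
    rw [pow_succ', pow_succ']
    exact abs_coeff_mul_le h₀ h₁ h₂ h₃ ih i

/-- Dropping the linear term changes the coefficients of the powers only slightly. -/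
lemma abs_coeff_pow_sub_le {U : ℤ} (h₀ : |m₀| ≤ U) (h₁ : |m₁| ≤ U) (h₂ : |m₂| ≤ U)
    (h₃ : |m₃| ≤ U) (h i : ℕ) :
    |((signedCubic m₀ m₁ m₂ m₃) ^ (h + 1) - (signedCubic m₀ 0 m₂ m₃) ^ (h + 1)).coeff i| ≤
      (h + 1) * |m₁| * (4 * U) ^ h := by
  have hsub (Q : ℤ[X]) : (signedCubic m₀ m₁ m₂ m₃ - signedCubic m₀ 0 m₂ m₃) * Q =
      -(C m₁ * (X * Q)) := by
    simp only [signedCubic, C_0]; ring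
  have hlin (Q : ℤ[X]) {B : ℤ} (hQ : ∀ i, |Q.coeff i| ≤ B) (i : ℕ) :
      |((signedCubic m₀ m₁ m₂ m₃ - signedCubic m₀ 0 m₂ m₃) * Q).coeff i| ≤ |m₁| * B := by
    have hB : 0 ≤ B := (abs_nonneg _).trans (hQ 0)
    rw [hsub, coeff_neg, abs_neg, coeff_C_mul, abs_mul]
    refine mul_le_mul_of_nonneg_left ?_ (abs_nonneg _)
    cases i with
    | zero => simpa using hB
    | succ i => rw [coeff_X_mul]; exact hQ i
  induction h generalizing i with
  | zero =>
    have := hlin 1 (B := 1) (fun i => by simp only [coeff_one]; split_ifs <;> simp) i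
    simpa using this
  | succ h ih =>
    have hU : 0 ≤ U := (abs_nonneg _).trans h₀
    have e : (signedCubic m₀ m₁ m₂ m₃) ^ (h + 1 + 1) - (signedCubic m₀ 0 m₂ m₃) ^ (h + 1 + 1) =
        signedCubic m₀ 0 m₂ m₃ *
          ((signedCubic m₀ m₁ m₂ m₃) ^ (h + 1) - (signedCubic m₀ 0 m₂ m₃) ^ (h + 1)) +
        (signedCubic m₀ m₁ m₂ m₃ - signedCubic m₀ 0 m₂ m₃) *
          (signedCubic m₀ m₁ m₂ m₃) ^ (h + 1) := by ring
    rw [e, coeff_add]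
    have a1 := abs_coeff_mul_le h₀ (by simpa using hU) h₂ h₃ ih i (m₁ := 0)
    have a2 := hlin _ (abs_coeff_pow_le h₀ h₁ h₂ h₃ (h + 1)) i
    refine (abs_add_le _ _).trans ((add_le_add a1 a2).trans (le_of_eq ?_))
    push_cast; ring

lemma pow_le_coeff_pow {L : ℤ} (hL : 0 ≤ L) (h₀ : L ≤ m₀) (h₂ : L ≤ m₂) (h₃ : L ≤ m₃) (h : ℕ) :
    (∀ i, 0 ≤ ((signedCubic m₀ 0 m₂ m₃) ^ (h + 1)).coeff i) ∧
    ∀ i ≤ 3 * (h + 1), i ≠ 1 → L ^ (h + 1) ≤ ((signedCubic m₀ 0 m₂ m₃) ^ (h + 1)).coeff i := by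
  have p₀ := hL.trans h₀
  have p₂ := hL.trans h₂
  have p₃ := hL.trans h₃
  induction h with
  | zero =>
    have e0 := coeff_mul_zero (m₀ := m₀) (m₁ := 0) (m₂ := m₂) (m₃ := m₃) 1
    have e1 := coeff_mul_one (m₀ := m₀) (m₁ := 0) (m₂ := m₂) (m₃ := m₃) 1
    have e2 := coeff_mul_two (m₀ := m₀) (m₁ := 0) (m₂ := m₂) (m₃ := m₃) 1
    have e3 := coeff_mul_add_three (m₀ := m₀) (m₁ := 0) (m₂ := m₂) (m₃ := m₃) 1
    simp only [coeff_one, mul_one] at e0 e1 e2 e3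
    simp only [zero_add, pow_one]
    constructor
    · intro i
      match i with
      | 0 => simp [e0, p₀]
      | 1 => simp [e1]
      | 2 => simp [e2, p₂]
      | i + 3 => rw [e3]; simp; split_ifs <;> simp [p₃]
    · intro i hi hi1
      match i, hi, hi1 with
      | 0, _, _ => simp [e0, h₀]
      | 2, _, _ => simp [e2, h₂]
      | 3, _, _ => have := e3 0; simp at this; rw [this]; exact h₃
  | succ h ih =>
    obtain ⟨ih0, ih1⟩ := ih
    rw [pow_succ', pow_succ' L]
    have key : ∀ {c : ℤ} (_ : L ≤ c) (j : ℕ) (_ : j ≤ 3 * (h + 1)) (_ : j ≠ 1),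
        L * L ^ (h + 1) ≤ c * ((signedCubic m₀ 0 m₂ m₃) ^ (h + 1)).coeff j := fun hc j hj hj1 =>
      mul_le_mul hc (ih1 j hj hj1) (pow_nonneg hL _) (hL.trans hc)
    constructor
    · intro i
      match i with
      | 0 => rw [coeff_mul_zero]; exact mul_nonneg p₀ (ih0 _)
      | 1 => rw [coeff_mul_one]; simpa using mul_nonneg p₀ (ih0 _)
      | 2 =>
        rw [coeff_mul_two]
        have := mul_nonneg p₀ (ih0 2); have := mul_nonneg p₂ (ih0 0)
        linarith
      | i + 3 =>
        rw [coeff_mul_add_three]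
        have := mul_nonneg p₀ (ih0 (i + 3)); have := mul_nonneg p₂ (ih0 (i + 1))
        have := mul_nonneg p₃ (ih0 i)
        linarith
    · intro i hi hi1
      match i, hi, hi1 with
      | 0, _, _ => rw [coeff_mul_zero]; exact key h₀ 0 (by omega) (by omega)
      | 2, _, _ =>
        rw [coeff_mul_two]
        have := key h₀ 2 (by omega) (by omega); have := mul_nonneg p₂ (ih0 0)
        linarith
      | i + 3, hi, _ =>
        rw [coeff_mul_add_three]
        have n0 := mul_nonneg p₀ (ih0 (i + 3)); have n2 := mul_nonneg p₂ (ih0 (i + 1))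
        have n3 := mul_nonneg p₃ (ih0 i)
        rcases (by omega : i + 3 ≤ 3 * (h + 1) ∨ (i + 1 ≤ 3 * (h + 1) ∧ i + 1 ≠ 1) ∨
          (i ≤ 3 * (h + 1) ∧ i ≠ 1)) with hc | hc | hc
        · linarith [key h₀ (i + 3) hc (by omega)]
        · linarith [key h₂ (i + 1) hc.1 hc.2]
        · linarith [key h₃ i hc.1 hc.2]

lemma coeff_zero_pow (h : ℕ) : ((signedCubic m₀ m₁ m₂ m₃) ^ h).coeff 0 = m₀ ^ h := by
  induction h with
  | zero => simp
  | succ h ih => rw [pow_succ', coeff_mul_zero, ih, pow_succ']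

lemma coeff_one_pow_neg (h₀ : 0 < m₀) (h₁ : 0 < m₁) (h : ℕ) :
    ((signedCubic m₀ m₁ m₂ m₃) ^ (h + 1)).coeff 1 < 0 := by
  induction h with
  | zero =>
    have e1 := coeff_mul_one (m₀ := m₀) (m₁ := m₁) (m₂ := m₂) (m₃ := m₃) 1
    simp [coeff_one] at e1
    simpa [e1] using h₁
  | succ h ih =>
    rw [pow_succ', coeff_mul_one, coeff_zero_pow]
    have := mul_neg_of_pos_of_neg h₀ ih
    have := mul_pos h₁ (pow_pos h₀ (h + 1))
    linarith

/-- If the linear coefficient is small, the powers have exactly one nonpositive coefficient. -/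
lemma coeff_pow_pos {L U : ℤ} (hL : 0 ≤ L) (hU : 0 ≤ U) (h₀ : L ≤ m₀) (h₂ : L ≤ m₂) (h₃ : L ≤ m₃)
    (u₀ : m₀ ≤ U) (u₁ : m₁ ≤ U) (u₂ : m₂ ≤ U) (u₃ : m₃ ≤ U) (h₁ : 0 ≤ m₁) {h : ℕ}
    (hsmall : (h + 1) * m₁ * (4 * U) ^ h < L ^ (h + 1)) {i : ℕ} (hi : i ≤ 3 * (h + 1))
    (hi1 : i ≠ 1) : 0 < ((signedCubic m₀ m₁ m₂ m₃) ^ (h + 1)).coeff i := by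
  have a := (pow_le_coeff_pow hL h₀ h₂ h₃ h).2 i hi hi1
  have b := abs_coeff_pow_sub_le (abs_le.mpr ⟨by linarith, u₀⟩) (abs_le.mpr ⟨by linarith, u₁⟩)
    (abs_le.mpr ⟨by linarith, u₂⟩) (abs_le.mpr ⟨by linarith, u₃⟩) h i
  rw [abs_of_nonneg h₁, coeff_sub, abs_le] at b
  linarith

lemma eval_eq (x : ℤ) : (signedCubic m₀ m₁ m₂ m₃).eval x =
    m₃ * x ^ 3 + m₂ * x ^ 2 - m₁ * x + m₀ := by
  simp [signedCubic]

end signedCubic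

lemma Nat.digits_sum_add_pow_mul {p : ℕ} (hp : 1 < p) (k a b : ℕ) (ha : a < p ^ k) :
    (p.digits (a + p ^ k * b)).sum = (p.digits a).sum + (p.digits b).sum := by
  have step (n : ℕ) : (p.digits n).sum = n % p + (p.digits (n / p)).sum := by
    rcases n.eq_zero_or_pos with rfl | hn
    · simp
    · rw [Nat.digits_def' hp hn]; simp
  induction k generalizing a with
  | zero => simp at ha; simp [ha]
  | succ k ih =>
    have hp0 : 0 < p := by omega
    rw [step, step a, pow_succ', mul_assoc, Nat.add_mul_mod_self_left,
      Nat.add_mul_div_left _ _ hp0, ih, add_assoc]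
    rw [Nat.div_lt_iff_lt_mul hp0, ← pow_succ]; exact ha

lemma Nat.digits_sum_sum_mul_pow {p : ℕ} (hp : 1 < p) (k N : ℕ) (f : ℕ → ℕ)
    (hf : ∀ i < N, f i < p ^ k) :
    (p.digits (∑ i ∈ Finset.range N, f i * (p ^ k) ^ i)).sum =
      ∑ i ∈ Finset.range N, (p.digits (f i)).sum := by
  induction N generalizing f with
  | zero => simp
  | succ N ih =>
    have e : ∑ i ∈ Finset.range (N + 1), f i * (p ^ k) ^ i =
        f 0 + p ^ k * ∑ i ∈ Finset.range N, f (i + 1) * (p ^ k) ^ i := by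
      rw [Finset.sum_range_succ', Finset.mul_sum, add_comm]
      congr 1
      · simp
      · exact Finset.sum_congr rfl fun i _ => by ring
    rw [e, Nat.digits_sum_add_pow_mul hp _ _ _ (hf 0 (by omega)),
      ih _ (fun i hi => hf (i + 1) (by omega)), Finset.sum_range_succ', add_comm]

lemma Nat.digits_sum_pow_sub {p : ℕ} (hp : 1 < p) {k b : ℕ} (hb : 0 < b) (hbk : b ≤ p ^ k) (j : ℕ) :
    (p.digits (p ^ (k + j) - b)).sum = (p.digits (p ^ k - b)).sum + j * (p - 1) := by
  induction j with
  | zero => simp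
  | succ j ih =>
    have hle : p ^ k ≤ p ^ (k + j) := Nat.pow_le_pow_right (by omega) (by omega)
    have e : p ^ (k + (j + 1)) - b = (p ^ (k + j) - b) + p ^ (k + j) * (p - 1) := by
      obtain ⟨q, rfl⟩ : ∃ q, p = q + 1 := ⟨p - 1, by omega⟩
      rw [← add_assoc, pow_succ, Nat.add_sub_cancel, mul_add]; omega
    rw [e, Nat.digits_sum_add_pow_mul hp _ _ _ (by omega), ih,
      Nat.digits_of_lt p (p - 1) (by omega) (by omega)]
    simp; ring

open Polynomial in
lemma digits_sum_eval_pow {p : ℕ} (hp : 1 < p) {P : ℤ[X]} {N k : ℕ} (hN : 2 ≤ N)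
    (hdeg : P.natDegree ≤ N) (hpos : ∀ i ≤ N, i ≠ 1 → 0 < P.coeff i) (hneg : P.coeff 1 < 0)
    (hk : ∀ i, |P.coeff i| < (p : ℤ) ^ k) :
    ∃ M : ℕ, ∀ j : ℕ, 0 ≤ P.eval ((p : ℤ) ^ (k + j)) ∧
      (p.digits (P.eval ((p : ℤ) ^ (k + j))).toNat).sum = M + j * (p - 1) := by
  set f : ℕ → ℕ → ℕ := fun j i =>
    (P.coeff i + (if i = 1 then (p : ℤ) ^ (k + j) else 0) - (if i = 2 then 1 else 0)).toNat with hf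
  have hle (j : ℕ) : (p : ℤ) ^ k ≤ (p : ℤ) ^ (k + j) :=
    pow_le_pow_right₀ (by exact_mod_cast hp.le) (by omega)
  have hcast (j i : ℕ) (hi : i ≤ N) : (f j i : ℤ) =
      P.coeff i + (if i = 1 then (p : ℤ) ^ (k + j) else 0) - (if i = 2 then 1 else 0) := by
    refine Int.toNat_of_nonneg ?_
    have h1 := hle j
    have h2 := abs_lt.mp (hk i)
    by_cases hi1 : i = 1
    · subst hi1; simp; linarith
    · have := hpos i hi hi1
      by_cases hi2 : i = 2
      · subst hi2; simp; omega
      · simp [hi1, hi2]; omega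
  have hlt (j i : ℕ) (hi : i ≤ N) : f j i < p ^ (k + j) := by
    have h1 := hle j
    have h2 := abs_lt.mp (hk i)
    zify
    rw [hcast j i hi]
    by_cases hi1 : i = 1
    · subst hi1; simp; linarith
    · simp only [hi1, if_false]
      split_ifs <;> linarith
  have hsum (j : ℕ) : P.eval ((p : ℤ) ^ (k + j)) =
      ((∑ i ∈ Finset.range (N + 1), f j i * (p ^ (k + j)) ^ i : ℕ) : ℤ) := by
    push_cast
    rw [Finset.sum_congr rfl fun i hi => by
      rw [hcast j i (by simpa [Nat.lt_succ_iff] using hi)]]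
    simp only [add_mul, sub_mul, Finset.sum_add_distrib, Finset.sum_sub_distrib, ite_mul, zero_mul,
      Finset.sum_ite_eq', Finset.mem_range]
    rw [if_pos (by omega), if_pos (by omega), ← eval_eq_sum_range' (by omega)]
    ring
  have hconst (j i : ℕ) : (p.digits (f j i)).sum =
      (p.digits (f 0 i)).sum + if i = 1 then j * (p - 1) else 0 := by
    by_cases hi1 : i = 1
    · subst hi1
      have h2 := abs_lt.mp (hk 1)
      have e (j : ℕ) : f j 1 = p ^ (k + j) - (-P.coeff 1).toNat := by
        have h1 := hle j
        zify
        rw [hcast j 1 (by omega), Nat.cast_sub (by zify; omega), Int.toNat_of_nonneg (by omega)]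
        simp; ring
      rw [e, e, Nat.digits_sum_pow_sub hp (by omega) (by zify; omega)]
      simp
    · simp [hf, hi1]
  refine ⟨∑ i ∈ Finset.range (N + 1), (p.digits (f 0 i)).sum, fun j => ?_⟩
  rw [hsum j]
  refine ⟨Int.natCast_nonneg _, ?_⟩
  rw [Int.toNat_natCast, Nat.digits_sum_sum_mul_pow hp _ _ _
    fun i hi => hlt j i (Nat.lt_succ_iff.mp hi)]
  simp only [hconst j, Finset.sum_add_distrib, Finset.sum_ite_eq', Finset.mem_range]
  rw [if_pos (by omega)]

/-- Moving `j` shifts the valuation of `n_j ^ h !` by `-j` modulo `m`, so all residues occur. -/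
lemma exists_padicValNat_factorial_mod_eq {p m r M : ℕ} (hp : p.Prime) (hr : r < m) (N : ℕ → ℕ)
    (hdig : ∀ j, (p.digits (N j)).sum = M + j * (p - 1))
    (hmod : ∀ j, N j ≡ N 0 [MOD m * (p - 1)]) :
    ∃ j < m, padicValNat p (N j).factorial % m = r := by
  have := Fact.mk hp
  have hp1 : 0 < p - 1 := Nat.sub_pos_of_lt hp.one_lt
  set v : ℕ → ℕ := fun j => padicValNat p (N j).factorial with hv
  have hleg (j : ℕ) : (p - 1) * (v j + j) + M = N j := by
    have h1 := sub_one_mul_padicValNat_factorial (p := p) (N j)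
    have h2 := Nat.digit_sum_le p (N j)
    rw [hdig] at h1 h2
    have : (p - 1) * (v j + j) = (p - 1) * v j + j * (p - 1) := by ring
    simp only [hv] at this ⊢
    omega
  have hshift (j : ℕ) : v j + j ≡ v 0 [MOD m] := by
    have h1 := hmod j
    rw [← hleg j, ← hleg 0, mul_comm m] at h1
    exact Nat.ModEq.mul_left_cancel' hp1.ne' (Nat.ModEq.add_right_cancel' _ h1)
  have hm : 0 < m := by omega
  set s := v 0 + (m - r) with hs
  refine ⟨s % m, Nat.mod_lt _ hm, ?_⟩
  have h1 : v (s % m) + s ≡ r + s [MOD m] := calc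
    v (s % m) + s ≡ v (s % m) + s % m [MOD m] := (Nat.mod_modEq s m).symm.add_left _
    _ ≡ v 0 [MOD m] := hshift _
    _ ≡ v 0 + m [MOD m] := by simp [Nat.ModEq]
    _ = r + s := by omega
  have h2 := Nat.ModEq.add_right_cancel' _ h1
  rw [Nat.ModEq, Nat.mod_eq_of_lt hr] at h2
  exact h2

lemma exists_signedCubic_eval {p h m d a r k : ℕ} (hp : p.Prime) (hr : r < m)
    (ha : a < d) {m₀ m₁ m₂ m₃ L U : ℤ} (hL : 0 < L) (hU : 0 ≤ U)
    (h₀ : L ≤ m₀) (h₂ : L ≤ m₂) (h₃ : L ≤ m₃)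
    (u₀ : m₀ ≤ U) (u₁ : m₁ ≤ U) (u₂ : m₂ ≤ U) (u₃ : m₃ ≤ U) (h₁ : 0 < m₁)
    (hsmall : (h + 1) * m₁ * (4 * U) ^ h < L ^ (h + 1)) (hk : (4 * U) ^ (h + 1) < (p : ℤ) ^ k)
    (d₀ : (d : ℤ) ∣ m₀ - a) (d₁ : ((d * m * (p - 1) : ℕ) : ℤ) ∣ m₁)
    (d₂ : ((d * m * (p - 1) : ℕ) : ℤ) ∣ m₂) (d₃ : ((d * m * (p - 1) : ℕ) : ℤ) ∣ m₃)
    (h₁₂ : m₁ ≤ m₂) :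
    ∃ j < m, ∃ n : ℕ, (n : ℤ) = (signedCubic m₀ m₁ m₂ m₃).eval ((p : ℤ) ^ (k + j)) ∧
      n % d = a ∧ padicValNat p (n ^ (h + 1)).factorial % m = r := by
  have ab {c : ℤ} (h0 : 0 ≤ c) (h1 : c ≤ U) : |c| ≤ U := abs_le.mpr ⟨by linarith, h1⟩
  obtain ⟨M, hM⟩ := digits_sum_eval_pow hp.one_lt (P := signedCubic m₀ m₁ m₂ m₃ ^ (h + 1))
    (N := 3 * (h + 1)) (k := k) (by omega) (signedCubic.natDegree_pow_le _)
    (fun i hi hi1 => signedCubic.coeff_pow_pos hL.le hU h₀ h₂ h₃ u₀ u₁ u₂ u₃ h₁.le hsmall hi hi1)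
    (signedCubic.coeff_one_pow_neg (by linarith) h₁ h)
    (fun i => (signedCubic.abs_coeff_pow_le (ab (by linarith) u₀) (ab h₁.le u₁)
      (ab (by linarith) u₂) (ab (by linarith) u₃) _ _).trans_lt hk)
  have hnn (j : ℕ) : 0 ≤ (signedCubic m₀ m₁ m₂ m₃).eval ((p : ℤ) ^ (k + j)) := by
    rw [signedCubic.eval_eq]
    have hx : (1 : ℤ) ≤ (p : ℤ) ^ (k + j) := one_le_pow₀ (by exact_mod_cast hp.one_lt.le)
    generalize (p : ℤ) ^ (k + j) = x at hx
    have e1 : 0 ≤ m₃ * x ^ 3 := mul_nonneg (by linarith) (by positivity)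
    have e2 : 0 ≤ (m₂ - m₁) * x ^ 2 := mul_nonneg (by linarith) (by positivity)
    have e3 : 0 ≤ m₁ * (x * (x - 1)) :=
      mul_nonneg h₁.le (mul_nonneg (by linarith) (by linarith))
    nlinarith
  choose n hn using fun j => Int.eq_ofNat_of_zero_le (hnn j)
  have hmod (j : ℕ) : ((d * m * (p - 1) : ℕ) : ℤ) ∣ n j - m₀ := by
    rw [← hn j, signedCubic.eval_eq, add_sub_cancel_right]
    exact dvd_sub (dvd_add (d₃.mul_right _) (d₂.mul_right _)) (d₁.mul_right _)
  have hmod' (j : ℕ) : n j ^ (h + 1) ≡ n 0 ^ (h + 1) [MOD m * (p - 1)] := by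
    refine Nat.ModEq.pow _ ?_
    rw [← Int.natCast_modEq_iff]
    refine Int.ModEq.symm ((Int.modEq_iff_dvd).mpr ?_)
    have := dvd_sub (hmod j) (hmod 0)
    rw [sub_sub_sub_cancel_right] at this
    exact dvd_trans (by rw [mul_assoc]; push_cast; exact Dvd.intro_left _ rfl) this
  obtain ⟨j, hj, hjr⟩ := exists_padicValNat_factorial_mod_eq hp hr (M := M)
    (fun j => n j ^ (h + 1)) (fun j => by
      have := (hM j).2
      rw [Polynomial.eval_pow, hn j, ← Nat.cast_pow, Int.toNat_natCast] at this
      exact this) hmod'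
  refine ⟨j, hj, n j, (hn j).symm, ?_, hjr⟩
  have hd : (d : ℤ) ∣ n j - a := by
    have h1 : (d : ℤ) ∣ n j - m₀ :=
      dvd_trans (by rw [mul_assoc]; push_cast; exact Dvd.intro _ rfl) (hmod j)
    have := dvd_add h1 d₀
    rwa [sub_add_sub_cancel] at this
  have h2 : a ≡ n j [MOD d] := by
    rw [← Int.natCast_modEq_iff]; exact Int.modEq_iff_dvd.mpr hd
  rw [← h2, Nat.mod_eq_of_lt ha]

lemma eq_and_eq_of_add_mul_eq {x u u' v v' : ℤ} (hu : 0 ≤ u) (hux : u < x) (hu' : 0 ≤ u')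
    (hux' : u' < x) (h : u + x * v = u' + x * v') : u = u' ∧ v = v' := by
  have h1 : u = u' := by
    have := congrArg (· % x) h
    simpa [Int.add_mul_emod_self_left, Int.emod_eq_of_lt hu hux, Int.emod_eq_of_lt hu' hux']
      using this
  subst h1
  exact ⟨rfl, mul_left_cancel₀ (by linarith : x ≠ 0) (by linarith)⟩

lemma signedCubic.eval_inj {x m₀ m₁ m₂ m₃ m₀' m₁' m₂' m₃' : ℤ}
    (h₀ : 0 ≤ m₀ ∧ m₀ < x) (h₀' : 0 ≤ m₀' ∧ m₀' < x) (h₁ : 0 ≤ m₁ ∧ m₁ < x)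
    (h₁' : 0 ≤ m₁' ∧ m₁' < x) (h₂ : 0 ≤ m₂ ∧ m₂ < x) (h₂' : 0 ≤ m₂' ∧ m₂' < x)
    (h : (signedCubic m₀ m₁ m₂ m₃).eval x = (signedCubic m₀' m₁' m₂' m₃').eval x) :
    m₀ = m₀' ∧ m₁ = m₁' ∧ m₂ = m₂' ∧ m₃ = m₃' := by
  rw [eval_eq, eval_eq] at h
  obtain ⟨e0, h⟩ := eq_and_eq_of_add_mul_eq h₀.1 h₀.2 h₀'.1 h₀'.2
    (v := m₃ * x ^ 2 + m₂ * x - m₁) (v' := m₃' * x ^ 2 + m₂' * x - m₁') (by linarith)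
  obtain ⟨e1, h⟩ := eq_and_eq_of_add_mul_eq h₁'.1 h₁'.2 h₁.1 h₁.2
    (v := m₃ * x + m₂) (v' := m₃' * x + m₂') (by linarith)
  obtain ⟨e2, e3⟩ := eq_and_eq_of_add_mul_eq h₂.1 h₂.2 h₂'.1 h₂'.2
    (v := m₃) (v' := m₃') (by linarith)
  exact ⟨e0, e1.symm, e2, e3⟩

lemma exists_pow_four_le_mul_card {p h m d a r : ℕ} (hp : p.Prime) (hr : r < m) (ha : a < d) :
    ∃ E : ℕ, 0 < E ∧ ∀ z : ℕ, 0 < z → ∀ x : ℕ, E * z ^ (3 * (h + 1) + 1) < x →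
      z ^ 4 ≤ m * ((Finset.range x).filter (fun n => n % d = a ∧
        padicValNat p (Nat.factorial (n ^ (h + 1))) % m = r)).card := by
  have hp1 : 0 < p - 1 := Nat.sub_pos_of_lt hp.one_lt
  have hp0 := hp.pos
  have hm : 0 < m := by omega
  have hd : 0 < d := by omega
  set D := d * m * (p - 1) with hD
  have hD0 : 0 < D := by positivity
  have hdD : d ≤ D := by rw [hD, mul_assoc]; exact Nat.le_mul_of_pos_right d (by positivity)
  obtain ⟨c, hc⟩ : ∃ c, c = (h + 1) * 8 ^ (h + 1) := ⟨_, rfl⟩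
  have hc0 : 0 < c := by rw [hc]; positivity
  refine ⟨6 * (D * c) * (p ^ (m + 1) * (8 * (D * c)) ^ (h + 1)) ^ 3, by positivity,
    fun z hz x hx => ?_⟩
  obtain ⟨L, hL⟩ : ∃ L, L = D * (c * z) := ⟨_, rfl⟩
  have hL0 : 0 < L := by rw [hL]; positivity
  have hzc : z ≤ c * z := Nat.le_mul_of_pos_left z hc0
  have hDz : D * z ≤ L := by rw [hL]; exact Nat.mul_le_mul_left D hzc
  obtain ⟨k, hk⟩ : ∃ k, k = Nat.log p ((8 * L) ^ (h + 1)) + 1 := ⟨_, rfl⟩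
  have hklt : (8 * L) ^ (h + 1) < p ^ k := hk ▸ Nat.lt_pow_succ_log_self hp.one_lt _
  have hkle : p ^ k ≤ p * (8 * L) ^ (h + 1) := by
    rw [hk, pow_succ']
    exact Nat.mul_le_mul_left p (Nat.pow_log_le_self p (by positivity))
  have hLk (j : ℕ) : 2 * L < p ^ (k + j) := calc
    2 * L ≤ 8 * L := by omega
    _ ≤ (8 * L) ^ (h + 1) := Nat.le_self_pow (by omega) _
    _ < p ^ k := hklt
    _ ≤ p ^ (k + j) := Nat.pow_le_pow_right hp0 (by omega)
  set lin : ℕ → ℕ := fun y => D * (y + 1) with hlin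
  set big : ℕ → ℕ := fun y => D * (c * z + y) with hbig
  have lin_le {y : ℕ} (hy : y < z) : lin y ≤ D * z := Nat.mul_le_mul_left D hy
  have le_big (y : ℕ) : L ≤ big y := by rw [hL]; exact Nat.mul_le_mul_left D (by omega)
  have big_le {y : ℕ} (hy : y < z) : big y + D ≤ 2 * L := by
    rw [hL, hbig]
    calc D * (c * z + y) + D = D * (c * z + (y + 1)) := by ring
      _ ≤ D * (2 * (c * z)) := Nat.mul_le_mul_left D (by omega)
      _ = _ := by ring
  have hsmall {y : ℕ} (hy : y < z) : (h + 1) * lin y * (8 * L) ^ h < L ^ (h + 1) := calc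
    (h + 1) * lin y * (8 * L) ^ h ≤ (h + 1) * (D * z) * (8 * L) ^ h := by
      gcongr; exact lin_le hy
    _ = (h + 1) * 8 ^ h * (D * z) * L ^ h := by rw [mul_pow]; ring
    _ < c * (D * z) * L ^ h := by
      gcongr ?_ * (D * z) * L ^ h
      rw [hc, pow_succ]
      have : 0 < 8 ^ h := by positivity
      gcongr; omega
    _ = L ^ (h + 1) := by rw [pow_succ, hL]; ring
  set cubic : ℕ × ℕ × ℕ × ℕ → Polynomial ℤ := fun y =>
    signedCubic ((big y.1 + a : ℕ) : ℤ) (lin y.2.1 : ℤ) (big y.2.2.1 : ℤ) (big y.2.2.2 : ℤ)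
    with hcubic
  set T := Finset.range z ×ˢ Finset.range z ×ˢ Finset.range z ×ˢ Finset.range z with hT
  have hex (y : ℕ × ℕ × ℕ × ℕ) : y ∈ T → ∃ j < m, ∃ n : ℕ,
      (n : ℤ) = (cubic y).eval ((p : ℤ) ^ (k + j)) ∧
      n % d = a ∧ padicValNat p (n ^ (h + 1)).factorial % m = r := by
    intro hy
    simp only [hT, Finset.mem_product, Finset.mem_range] at hy
    obtain ⟨y0, y1, y2, y3⟩ := hy
    have b0 := big_le y0; have b2 := big_le y2; have b3 := big_le y3
    have l0 := le_big y.1; have l2 := le_big y.2.2.1; have l3 := le_big y.2.2.2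
    have b1 := lin_le y1
    refine exists_signedCubic_eval hp hr ha (L := L) (U := (2 * L : ℕ)) (by exact_mod_cast hL0)
      (by positivity) (by exact_mod_cast (by omega)) (by exact_mod_cast l2)
      (by exact_mod_cast l3) (by exact_mod_cast (by omega)) (by exact_mod_cast (by omega))
      (by exact_mod_cast (by omega)) (by exact_mod_cast (by omega))
      (by simp only [hlin]; positivity) ?_ ?_ ?_ ?_ ?_ ?_ (by exact_mod_cast (by omega))
    · have := hsmall y1
      rw [show 8 * L = 4 * (2 * L) by ring] at this
      exact_mod_cast this
    · rw [show 8 * L = 4 * (2 * L) by ring] at hklt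
      exact_mod_cast hklt
    · push_cast
      rw [add_sub_cancel_right]
      refine Int.natCast_dvd_natCast.mpr ?_
      exact dvd_mul_of_dvd_left ((Dvd.intro _ rfl : d ∣ d * m).mul_right _) _
    · exact Int.natCast_dvd_natCast.mpr (Dvd.intro _ rfl)
    · exact Int.natCast_dvd_natCast.mpr (Dvd.intro _ rfl)
    · exact Int.natCast_dvd_natCast.mpr (Dvd.intro _ rfl)
  choose! j hj n hn hna hnr using hex
  have hcard : T.card = z ^ 4 := by simp [hT, Finset.card_product]; ring
  rw [← hcard, ← Finset.card_range m, ← Finset.card_product, Finset.card_range]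
  refine Finset.card_le_card_of_injOn (fun y => (j y, n y)) (fun y hy => ?_)
    fun y hy y' hy' hyy => ?_
  · have hy : y ∈ T := hy
    have hyn := hn y hy
    have hyj := hj y hy
    simp only [Finset.coe_product, Set.mem_prod, Finset.mem_coe, Finset.mem_range,
      Finset.mem_filter]
    refine ⟨hyj, ?_, hna y hy, hnr y hy⟩
    simp only [hT, Finset.mem_product, Finset.mem_range] at hy
    obtain ⟨y0, y1, y2, y3⟩ := hy
    have b0 := big_le y0; have b2 := big_le y2; have b3 := big_le y3
    obtain ⟨q, hq⟩ : ∃ q, q = p ^ (k + j y) := ⟨_, rfl⟩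
    have hq0 : 1 ≤ q := hq ▸ Nat.one_le_pow _ _ hp0
    have hqle : q ≤ p ^ (m + 1) * (8 * L) ^ (h + 1) := calc
      q = p ^ k * p ^ j y := by rw [hq, pow_add]
      _ ≤ (p * (8 * L) ^ (h + 1)) * p ^ m :=
        Nat.mul_le_mul hkle (Nat.pow_le_pow_right hp0 hyj.le)
      _ = _ := by ring
    have hnq : n y + lin y.2.1 * q = big y.2.2.2 * q ^ 3 + big y.2.2.1 * q ^ 2 + (big y.1 + a) := by
      zify
      rw [hyn, hcubic, signedCubic.eval_eq, hq]
      push_cast; ring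
    have q12 : q ^ 2 ≤ q ^ 3 := Nat.pow_le_pow_right hq0 (by omega)
    have q13 : 1 ≤ q ^ 3 := Nat.one_le_pow _ _ hq0
    calc n y ≤ big y.2.2.2 * q ^ 3 + big y.2.2.1 * q ^ 2 + (big y.1 + a) := by
          rw [← hnq]; exact Nat.le_add_right _ _
      _ ≤ (2 * L) * q ^ 3 + (2 * L) * q ^ 3 + (2 * L) * q ^ 3 := by
          refine Nat.add_le_add (Nat.add_le_add (Nat.mul_le_mul_right _ (by omega))
            (Nat.mul_le_mul (by omega) q12)) ?_
          calc big y.1 + a ≤ 2 * L * 1 := by omega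
            _ ≤ _ := Nat.mul_le_mul_left _ q13
      _ = 6 * L * q ^ 3 := by ring
      _ ≤ 6 * L * (p ^ (m + 1) * (8 * L) ^ (h + 1)) ^ 3 := by gcongr
      _ = 6 * (D * c) * (p ^ (m + 1) * (8 * (D * c)) ^ (h + 1)) ^ 3 * z ^ (3 * (h + 1) + 1) := by
          rw [hL, show 8 * (D * (c * z)) = (8 * (D * c)) * z by ring, mul_pow (8 * (D * c)) z]
          ring
      _ < x := hx
  · have hy : y ∈ T := hy
    have hy' : y' ∈ T := hy'
    simp only [Prod.mk.injEq] at hyy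
    have e : (cubic y).eval ((p : ℤ) ^ (k + j y)) = (cubic y').eval ((p : ℤ) ^ (k + j y)) := by
      rw [← hn y hy, hyy.2, hn y' hy', hyy.1]
    have hlt := hLk (j y)
    simp only [hT, Finset.mem_product, Finset.mem_range] at hy hy'
    obtain ⟨y0, y1, y2, y3⟩ := hy
    obtain ⟨y0', y1', y2', y3'⟩ := hy'
    have bd {u : ℕ} (hu : u ≤ 2 * L) : (0 : ℤ) ≤ u ∧ (u : ℤ) < (p : ℤ) ^ (k + j y) :=
      ⟨by positivity, by exact_mod_cast hu.trans_lt hlt⟩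
    have b0 := big_le y0; have b0' := big_le y0'
    have b1 := lin_le y1; have b1' := lin_le y1'
    have b2 := big_le y2; have b2' := big_le y2'
    obtain ⟨e0, e1, e2, e3⟩ := signedCubic.eval_inj (bd (by omega)) (bd (by omega))
      (bd (by omega)) (bd (by omega)) (bd (by omega)) (bd (by omega)) e
    have big_inj {u v : ℕ} (huv : big u = big v) : u = v := by
      have := Nat.eq_of_mul_eq_mul_left hD0 huv; omega
    have lin_inj {u v : ℕ} (huv : lin u = lin v) : u = v := by
      have := Nat.eq_of_mul_eq_mul_left hD0 huv; omega
    exact Prod.ext (big_inj (by have := Int.ofNat.inj e0; omega))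
      (Prod.ext (lin_inj (by exact_mod_cast e1))
        (Prod.ext (big_inj (by exact_mod_cast e2)) (big_inj (by exact_mod_cast e3))))

theorem theorem2_lower_bound (p : ℕ) (hp : p.Prime) (h m d a r : ℕ)
    (hh : 2 ≤ h) (hm : 1 ≤ m) (hd : 1 ≤ d) (ha : a < d) (hr : r < m) :
    ∃ C' : ℝ, 0 < C' ∧ ∃ x0 : ℕ, ∀ x : ℕ, x0 ≤ x →
      C' * (x : ℝ) ^ ((4 : ℝ) / (3 * (h : ℝ) + 1)) ≤
        (((Finset.range x).filter
          (fun n => n % d = a ∧ padicValNat p (Nat.factorial (n ^ h)) % m = r)).card : ℝ) := by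
  obtain ⟨h, rfl⟩ : ∃ h', h = h' + 1 := ⟨h - 1, by omega⟩
  obtain ⟨E, hE, hcount⟩ := exists_pow_four_le_mul_card (h := h) hp hr ha
  set e := 3 * (h + 1) + 1 with he
  have hs : (4 : ℝ) / (3 * ((h + 1 : ℕ) : ℝ) + 1) = 4 / (e : ℝ) := by rw [he]; push_cast; rfl
  have he0 : (e : ℝ) ≠ 0 := by positivity
  rw [hs]
  have hEs : 0 < (E : ℝ) ^ (4 / (e : ℝ)) := Real.rpow_pos_of_pos (by exact_mod_cast hE) _
  have hm0 : (0 : ℝ) < m := by exact_mod_cast hm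
  refine ⟨((E : ℝ) ^ (4 / (e : ℝ)) * 16 * m)⁻¹, by positivity, E + 1, fun x hx => ?_⟩
  rw [inv_mul_le_iff₀ (by positivity)]
  have hexists : ∃ z, x ≤ E * (z + 1) ^ e :=
    ⟨x, (Nat.le_succ x).trans ((Nat.le_self_pow (by omega) _).trans (Nat.le_mul_of_pos_left _ hE))⟩
  obtain ⟨z, hz, hzmin⟩ : ∃ z, x ≤ E * (z + 1) ^ e ∧ ∀ w < z, ¬ x ≤ E * (w + 1) ^ e :=
    ⟨Nat.find hexists, Nat.find_spec hexists, fun w hw => Nat.find_min hexists hw⟩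
  have hz0 : 0 < z := by
    rcases z.eq_zero_or_pos with rfl | hz0
    · simp at hz; omega
    · exact hz0
  have hzx : E * z ^ e < x := by
    have := hzmin (z - 1) (by omega)
    rwa [Nat.sub_add_cancel hz0, not_le] at this
  have hcard := (Nat.cast_le (α := ℝ)).mpr (hcount z hz0 x hzx)
  rw [Nat.cast_mul, Nat.cast_pow] at hcard
  have hx2 : (x : ℝ) ≤ E * (2 * z : ℝ) ^ e := by
    have : x ≤ E * (2 * z) ^ e := hz.trans (by gcongr; omega)
    exact_mod_cast this
  calc (x : ℝ) ^ (4 / (e : ℝ)) ≤ (E * (2 * z : ℝ) ^ e) ^ (4 / (e : ℝ)) :=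
        Real.rpow_le_rpow (by positivity) hx2 (by positivity)
    _ = (E : ℝ) ^ (4 / (e : ℝ)) * 16 * (z : ℝ) ^ 4 := by
        rw [Real.mul_rpow (by positivity) (by positivity), ← Real.rpow_natCast (2 * z : ℝ) e,
          ← Real.rpow_mul (by positivity), mul_div_cancel₀ _ he0,
          show (4 : ℝ) = ((4 : ℕ) : ℝ) by norm_num, Real.rpow_natCast]
        ring
    _ ≤ (E : ℝ) ^ (4 / (e : ℝ)) * 16 * (m * _) :=
        mul_le_mul_of_nonneg_left hcard (by positivity)
    _ = _ := (mul_assoc _ _ _).symm
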